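/- There do not exist real numbers γ_{m,i} for 1 ≤ m ≤ 3, 0 ≤ i ≤ m−1, with Σ_{i=0}^{m−1} γ_{m,i} = 1 for each m, such that the coefficients β_{j,m} defined by the stated recursion with M = 3 satisfy both consistency equations β_{2,3}/β_{1,3}² = 1/2 and β_{3,3}/β_{1,3}² = 1 (with β_{1,3} ≠ 0) while the quantities S̃ defined by the stated downward recursion satisfy S̃_{m,m} > 0 for m = 1, 2, 3; i.e., there is no unconditionally energy stable second order three-stage threshold dynamics method of this type. -/

import Mathlib

/-- The recursion defining the consistency coefficients `β_{j,m}`, `j = 1,…,5`,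
`m = 0,…,M`, of the `M`-stage threshold dynamics scheme with weights `γ`. -/
def betaRec (M : ℕ) (γ β : ℕ → ℕ → ℝ) : Prop :=
  (∀ j, β j 0 = 0) ∧
  ∀ m, 1 ≤ m → m ≤ M →
    β 1 m = 1 + ∑ i ∈ Finset.range m, γ m i * β 1 i ∧
    β 2 m = 1 / 2 + (∑ i ∈ Finset.range m, γ m i * β 2 i)
      + ∑ i ∈ Finset.range m, γ m i * β 4 i ∧
    β 3 m = 2 / 3 + (1 / 6) * (∑ i ∈ Finset.range m, γ m i * β 1 i) ^ 3
      - (1 / 4) * (∑ i ∈ Finset.range m, γ m i * β 1 i)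
          * (∑ i ∈ Finset.range m, γ m i * (β 1 i) ^ 2)
      + (1 / 12) * (∑ i ∈ Finset.range m, γ m i * (β 1 i) ^ 3)
      + (∑ i ∈ Finset.range m, γ m i * β 3 i)
      + ∑ i ∈ Finset.range m, γ m i * β 5 i ∧
    β 4 m = 1 + ∑ i ∈ Finset.range m, γ m i * β 4 i ∧
    β 5 m = 2 + ∑ i ∈ Finset.range m, γ m i * β 5 i

/-- The downward recursion defining the stability coefficients `γ̃_{m,i}` and the
partial sums `S̃_{j,m}` from the weights `γ` of an `M`-stage scheme. -/
def tildeRec (M : ℕ) (γ γt St : ℕ → ℕ → ℝ) : Prop :=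
  (∀ i < M, γt M i = γ M i) ∧
  (∀ m, 1 ≤ m → m < M → ∀ i < m,
    γt m i = γ m i - ∑ j ∈ Finset.Icc (m + 1) M, γt j i * St j m / St j j) ∧
  (∀ j m : ℕ, St j m = ∑ i ∈ Finset.range m, γt j i)

set_option maxHeartbeats 2000000 in
theorem core_aux (a b c s u : ℝ) (hs : s = b + c * (1 + a)) (hu : u = 1 - b - c)
    (hy : 1 + s ≠ 0)
    (h1 : 2 * (a * c) = s * (s - 1))
    (h2 : (s + 1) * (s ^ 2 - s - 8) + 3 * (s * (s - 1)) * (a * (a - s)) = 0)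
    (h3 : 0 < 1 - (1 - c) ^ 2)
    (h4 : 0 < 1 - u ^ 2 - (1 - a - u * (1 - c)) ^ 2 / (1 - (1 - c) ^ 2)) : False := by
  have hu2 : u = (s - 1) * (s - 2) / 2 := by
    have : u = 1 + a * c - s := by rw [hs, hu]; ring
    rw [this]; linarith
  have hq : 0 ≤ (1 - a - u * (1 - c)) ^ 2 / (1 - (1 - c) ^ 2) := by positivity
  have hu1 : u < 1 := by nlinarith
  have hs0 : 0 < s ∧ s < 3 := by
    have : s * (s - 3) < 0 := by nlinarith
    constructor <;> nlinarith
  have hc : 0 < c := by nlinarith [sq_nonneg c]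
  have h5 : (1 - a - u * (1 - c)) ^ 2 < (1 - u ^ 2) * (1 - (1 - c) ^ 2) := by
    rw [← div_lt_iff₀ h3]; linarith
  have h6 : 0 < (1 - (1 - a) ^ 2) * (1 - (1 - c) ^ 2) := by
    nlinarith [sq_nonneg (u - (1 - a) * (1 - c))]
  have h7 : 0 < 1 - (1 - a) ^ 2 := pos_of_mul_pos_left h6 h3.le
  have ha : 0 < a := by nlinarith
  have ha2 : a < 2 := by nlinarith
  obtain ⟨hs0, hs3⟩ := hs0
  have hs1 : 1 < s := by
    have : 0 < s * (s - 1) := by rw [← h1]; positivity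
    have := pos_of_mul_pos_right this hs0.le
    linarith
  have h8 : s ^ 2 - s - 8 < 0 := by
    have : 0 < (3 - s) * (s + 2) := mul_pos (by linarith) (by linarith)
    linarith
  have hk : 0 < s * (s - 1) := mul_pos hs0 (by linarith)
  have h9 : 0 < 3 * (s * (s - 1)) * (a * (a - s)) := by
    have : 0 < (s + 1) * -(s ^ 2 - s - 8) := mul_pos (by linarith) (by linarith)
    linarith
  have h10 : 0 < a * (a - s) := pos_of_mul_pos_right h9 (by positivity)
  have h11 : s < a := by have := pos_of_mul_pos_right h10 ha.le; linarith
  have h12 : a * (a - s) ≤ 2 * (2 - s) :=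
    mul_le_mul ha2.le (by linarith) (by linarith) (by norm_num)
  have h13 : s * (s - 1) ≤ 2 * (s - 1) :=
    mul_le_mul_of_nonneg_right (by linarith) (by linarith)
  have h14 : (s * (s - 1)) * (a * (a - s)) ≤ (2 * (s - 1)) * (2 * (2 - s)) :=
    mul_le_mul h13 h12 h10.le (by linarith)
  have h15 : (s + 1) * (s ^ 2 - s - 8) ≤ -12 := by
    have : 0 < (s - 1) * (2 - s) * (s + 3) :=
      mul_pos (mul_pos (by linarith) (by linarith)) (by linarith)
    linarith
  linarith [sq_nonneg (2 * s - 3)]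

/-- There is no unconditionally energy stable, second order accurate three-stage
threshold dynamics scheme: no weights `γ` with unit row sums satisfy both
consistency equations and the stability conditions `S̃_{m,m} > 0` simultaneously. -/
theorem no_second_order_stable_three_stage :
    ¬ ∃ (γ β γt St : ℕ → ℕ → ℝ),
      (∀ m, 1 ≤ m → m ≤ 3 → ∑ i ∈ Finset.range m, γ m i = 1) ∧
      betaRec 3 γ β ∧ β 1 3 ≠ 0 ∧
      β 2 3 / (β 1 3) ^ 2 = 1 / 2 ∧ β 3 3 / (β 1 3) ^ 2 = 1 ∧
      tildeRec 3 γ γt St ∧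
      (∀ m, 1 ≤ m → m ≤ 3 → 0 < St m m) := by
  rintro ⟨γ, β, γt, St, hg, ⟨hb0, hb⟩, hy, e1, e2, ⟨t3, t2, tS⟩, hpos⟩
  have g1 := hg 1 (by norm_num) (by norm_num)
  have g2 := hg 2 (by norm_num) (by norm_num)
  have g3 := hg 3 (by norm_num) (by norm_num)
  obtain ⟨p11, p21, p31, p41, p51⟩ := hb 1 (by norm_num) (by norm_num)
  obtain ⟨p12, p22, p32, p42, p52⟩ := hb 2 (by norm_num) (by norm_num)
  obtain ⟨p13, p23, p33, p43, p53⟩ := hb 3 (by norm_num) (by norm_num)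
  have q1 := hpos 1 (by norm_num) (by norm_num)
  have q2 := hpos 2 (by norm_num) (by norm_num)
  have t30 := t3 0 (by norm_num)
  have t31 := t3 1 (by norm_num)
  have t32 := t3 2 (by norm_num)
  have t20 := t2 2 (by norm_num) (by norm_num) 0 (by norm_num)
  have t21 := t2 2 (by norm_num) (by norm_num) 1 (by norm_num)
  have t10 := t2 1 (by norm_num) (by norm_num) 0 (by norm_num)
  have i1 : Finset.Icc (2 + 1) 3 = {3} := by decide
  have i2 : Finset.Icc (1 + 1) 3 = {2, 3} := by decide
  rw [i1, Finset.sum_singleton] at t20 t21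
  rw [i2, Finset.sum_pair (by norm_num)] at t10
  have s11 := tS 1 1
  have s22 := tS 2 2
  have s21 := tS 2 1
  have s33 := tS 3 3
  have s32 := tS 3 2
  have s31 := tS 3 1
  simp only [Finset.sum_range_succ, Finset.sum_range_zero, hb0, zero_add, mul_zero, add_zero,
    ne_eq, OfNat.ofNat_ne_zero, not_false_eq_true, zero_pow] at *
  rw [div_eq_iff (pow_ne_zero 2 hy)] at e1 e2
  generalize γ 2 1 = a at *
  generalize γ 3 1 = b at *
  generalize γ 3 2 = c at *
  have g20 : γ 2 0 = 1 - a := by linarith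
  have g30 : γ 3 0 = 1 - b - c := by linarith
  have S33 : St 3 3 = 1 := by rw [s33, t30, t31, t32]; linarith
  have S32 : St 3 2 = 1 - c := by rw [s32, t30, t31]; linarith
  have S31 : St 3 1 = 1 - b - c := by rw [s31, t30]; linarith
  rw [S33, S32, div_one] at t20 t21
  have T20 : γt 2 0 = 1 - a - (1 - b - c) * (1 - c) := by rw [t20, t30, g20, g30]
  have S22 : St 2 2 = 1 - (1 - c) ^ 2 := by rw [s22, t21, T20, t31]; ring
  have S11 : St 1 1 = 1 - (1 - b - c) ^ 2
      - (1 - a - (1 - b - c) * (1 - c)) ^ 2 / (1 - (1 - c) ^ 2) := by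
    rw [s11, t10, s21, S22, S33, S31, T20, t30, g30, g1]; ring
  rw [S22] at q2
  rw [S11] at q1
  have B12 : β 1 2 = 1 + a := by rw [p12, p11]; ring
  have B42 : β 4 2 = 1 + a := by rw [p42, p41]; ring
  have B52 : β 5 2 = 2 * (1 + a) := by rw [p52, p51]; ring
  have B13 : β 1 3 = 1 + (b + c * (1 + a)) := by rw [p13, p11, B12]; ring
  have B22 : β 2 2 = 1 / 2 + 3 * a / 2 := by rw [p22, p21, p41]; ring
  have B31 : β 3 1 = 2 / 3 := by rw [p31]; ring
  have B32 : β 3 2 = 2 / 3 + 11 * a / 4 - a ^ 2 / 4 + a ^ 3 / 6 := by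
    rw [p32, p11, B31, p51]; ring
  rw [p23, B22, p21, p41, B42, B13] at e1
  rw [p33, B32, B31, p11, B12, p51, B52, B13] at e2
  rw [B13] at hy
  have k1 : 2 * (a * c) = (b + c * (1 + a)) * ((b + c * (1 + a)) - 1) := by
    linear_combination 2 * e1
  refine core_aux a b c (b + c * (1 + a)) (1 - b - c) rfl rfl hy k1 ?_ q2 q1
  obtain ⟨s, hs⟩ : ∃ s, s = b + c * (1 + a) := ⟨_, rfl⟩
  have hb' : b = s - c * (1 + a) := by linarith
  subst hb'
  linear_combination 24 * e2 - 3 * (9 + a ^ 2 - s - s * a) * k1
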